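/- For all admissible parameters (p, x, σ, β) with z = p − Σ_{i=1}^{n−1} x_i²/σ_i > 0, the curvature operator R of the inner product S(p, x, σ, β) on 𝔠𝔥(n) is not identically zero; i.e., no left invariant Riemannian metric on the Lie group CH(n) is flat. -/

import Mathlib

noncomputable section

open Matrix BigOperators Finset

namespace CHn

/-- Structure constants of the Lie algebra 𝔠𝔥(n) in the ordered basis
`(X, Y_1, …, Y_{n-1}, Z_1, …, Z_{n-1}, W)`:
index `0 ↦ X`, indices `1,…,n-1 ↦ Y_1,…,Y_{n-1}`,
indices `n,…,2n-2 ↦ Z_1,…,Z_{n-1}`, index `2n-1 ↦ W`.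
The nonzero brackets are `[X,Y_i] = (1/2)Y_i`, `[X,Z_i] = (1/2)Z_i`,
`[X,W] = W`, `[Z_j,Y_i] = δ_{ij} W`. -/
def structC (n : ℕ) (i j k : Fin (2 * n)) : ℝ :=
  (if i.val = 0 ∧ j = k ∧ 1 ≤ j.val ∧ j.val ≤ 2 * n - 2 then (1 : ℝ) / 2 else 0)
  - (if j.val = 0 ∧ i = k ∧ 1 ≤ i.val ∧ i.val ≤ 2 * n - 2 then (1 : ℝ) / 2 else 0)
  + (if i.val = 0 ∧ j.val = 2 * n - 1 ∧ k.val = 2 * n - 1 then (1 : ℝ) else 0)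
  - (if j.val = 0 ∧ i.val = 2 * n - 1 ∧ k.val = 2 * n - 1 then (1 : ℝ) else 0)
  + (if n ≤ i.val ∧ i.val ≤ 2 * n - 2 ∧ i.val = j.val + (n - 1) ∧ k.val = 2 * n - 1
      then (1 : ℝ) else 0)
  - (if n ≤ j.val ∧ j.val ≤ 2 * n - 2 ∧ j.val = i.val + (n - 1) ∧ k.val = 2 * n - 1
      then (1 : ℝ) else 0)

/-- The Lie bracket of `𝔠𝔥(n)`, as a bilinear operation on coordinate vectors. -/
def bracket (n : ℕ) (u v : Fin (2 * n) → ℝ) : Fin (2 * n) → ℝ :=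
  fun k => ∑ i, ∑ j, u i * v j * structC n i j k

/-- `F` is the matrix (in the ordered basis) of a Lie algebra automorphism of `𝔠𝔥(n)`. -/
def IsAut (n : ℕ) (F : Matrix (Fin (2 * n)) (Fin (2 * n)) ℝ) : Prop :=
  IsUnit F ∧ ∀ u v, F.mulVec (bracket n u v) = bracket n (F.mulVec u) (F.mulVec v)

/-- The normal form `S(p, x, σ, β)`: the block matrix
`[[p, xᵀ, 0, 0], [x, σ, 0, 0], [0, 0, σ, 0], [0, 0, 0, β]]`
with blocks of sizes `1, n-1, n-1, 1`. -/
def Sform (n : ℕ) (p : ℝ) (x σ : Fin (n - 1) → ℝ) (β : ℝ) :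
    Matrix (Fin (2 * n)) (Fin (2 * n)) ℝ := fun i j =>
  if i.val = 0 ∧ j.val = 0 then p
  else if h : i.val = 0 ∧ 1 ≤ j.val ∧ j.val ≤ n - 1 then x ⟨j.val - 1, by omega⟩
  else if h : j.val = 0 ∧ 1 ≤ i.val ∧ i.val ≤ n - 1 then x ⟨i.val - 1, by omega⟩
  else if h : i = j ∧ 1 ≤ i.val ∧ i.val ≤ n - 1 then σ ⟨i.val - 1, by omega⟩
  else if h : i = j ∧ n ≤ i.val ∧ i.val ≤ 2 * n - 2 then σ ⟨i.val - n, by omega⟩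
  else if i = j ∧ i.val = 2 * n - 1 then β
  else 0

/-- Admissibility of the parameters `(p, x, σ, β)`:
`p, β > 0`, all `x_i ≥ 0`, `σ_1 ≥ … ≥ σ_{n-2} ≥ 1` and the convention `σ_{n-1} = 1`. -/
def Admissible (n : ℕ) (p : ℝ) (x σ : Fin (n - 1) → ℝ) (β : ℝ) : Prop :=
  0 < p ∧ 0 < β ∧ (∀ i, 0 ≤ x i) ∧ Antitone σ ∧ (∀ i, 1 ≤ σ i) ∧
    ∀ _h : 1 ≤ n - 1, σ ⟨n - 2, by omega⟩ = 1

/-- `z = p - Σ_i x_i² / σ_i`. -/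
def zval (n : ℕ) (p : ℝ) (x σ : Fin (n - 1) → ℝ) : ℝ :=
  p - ∑ i, (x i) ^ 2 / σ i

/-- The inner product on `𝔠𝔥(n)` determined by a matrix `S`. -/
def ip (n : ℕ) (S : Matrix (Fin (2 * n)) (Fin (2 * n)) ℝ) (u v : Fin (2 * n) → ℝ) : ℝ :=
  u ⬝ᵥ S.mulVec v

/-- The coordinates (w.r.t. the standard basis) of the Koszul form
`K(u,v)(T) = ⟨[u,v],T⟩ - ⟨[v,T],u⟩ + ⟨[T,u],v⟩`. -/
def koszul (n : ℕ) (S : Matrix (Fin (2 * n)) (Fin (2 * n)) ℝ)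
    (u v : Fin (2 * n) → ℝ) : Fin (2 * n) → ℝ := fun t =>
  ip n S (bracket n u v) (Pi.single t 1) - ip n S (bracket n v (Pi.single t 1)) u
    + ip n S (bracket n (Pi.single t 1) u) v

/-- The Levi-Civita product `∇_u v` of the inner product `S`,
i.e. the unique solution of the Koszul formula `2⟨∇_u v, T⟩ = K(u,v)(T)`
(for invertible symmetric `S`). -/
def nabla (n : ℕ) (S : Matrix (Fin (2 * n)) (Fin (2 * n)) ℝ)
    (u v : Fin (2 * n) → ℝ) : Fin (2 * n) → ℝ :=
  (2 : ℝ)⁻¹ • (S⁻¹).mulVec (koszul n S u v)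

/-- The curvature operator `R(u,v)w = ∇_u∇_v w - ∇_v∇_u w - ∇_{[u,v]} w`. -/
def curv (n : ℕ) (S : Matrix (Fin (2 * n)) (Fin (2 * n)) ℝ)
    (u v w : Fin (2 * n) → ℝ) : Fin (2 * n) → ℝ :=
  nabla n S u (nabla n S v w) - nabla n S v (nabla n S u w) - nabla n S (bracket n u v) w

/-- The Ricci form `Ric(u,v) = tr (T ↦ R(T,u)v)`. -/
def ricci (n : ℕ) (S : Matrix (Fin (2 * n)) (Fin (2 * n)) ℝ)
    (u v : Fin (2 * n) → ℝ) : ℝ :=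
  ∑ t, curv n S (Pi.single t 1) u v t

/-- The scalar curvature `τ = Σ_{i,j} g^{ij} Ric(e_i, e_j)`. -/
def scalarCurv (n : ℕ) (S : Matrix (Fin (2 * n)) (Fin (2 * n)) ℝ) : ℝ :=
  ∑ i, ∑ j, (S⁻¹) i j * ricci n S (Pi.single i 1) (Pi.single j 1)

/-- The wedge endomorphism `(u∧v)(w) = ⟨v,w⟩u - ⟨u,w⟩v`. -/
def wedge (n : ℕ) (S : Matrix (Fin (2 * n)) (Fin (2 * n)) ℝ)
    (u v : Fin (2 * n) → ℝ) : (Fin (2 * n) → ℝ) → (Fin (2 * n) → ℝ) :=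
  fun w => ip n S v w • u - ip n S u w • v

/-- The standard symplectic matrix `J_m = [[0, I_m], [-I_m, 0]]`. -/
def Jmat (m : ℕ) : Matrix (Fin (2 * m)) (Fin (2 * m)) ℝ := fun i j =>
  if j.val = i.val + m then 1 else if i.val = j.val + m then -1 else 0

/-- The block matrix `[[1, 0, 0], [u, M, 0], [a, vᵀ, λ]]`
with blocks of sizes `1, 2n-2, 1`. -/
def blockF (n : ℕ) (M : Matrix (Fin (2 * (n - 1))) (Fin (2 * (n - 1))) ℝ)
    (u v : Fin (2 * (n - 1)) → ℝ) (a lam : ℝ) :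
    Matrix (Fin (2 * n)) (Fin (2 * n)) ℝ := fun i j =>
  if i.val = 0 then (if j.val = 0 then 1 else 0)
  else if h : 1 ≤ i.val ∧ i.val ≤ 2 * n - 2 then
    (if j.val = 0 then u ⟨i.val - 1, by omega⟩
     else if h2 : 1 ≤ j.val ∧ j.val ≤ 2 * n - 2 then
       M ⟨i.val - 1, by omega⟩ ⟨j.val - 1, by omega⟩
     else 0)
  else
    (if j.val = 0 then a
     else if h2 : 1 ≤ j.val ∧ j.val ≤ 2 * n - 2 then v ⟨j.val - 1, by omega⟩
     else lam)

/-- The metric is Einstein: the Ricci form is proportional to the inner product. -/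
def IsEinstein (n : ℕ) (S : Matrix (Fin (2 * n)) (Fin (2 * n)) ℝ) : Prop :=
  ∃ c : ℝ, ∀ u v, ricci n S u v = c * ip n S u v

end CHn

namespace CHn


def eX (n : ℕ) (hn : 2 ≤ n) : Fin (2 * n) := ⟨0, by omega⟩
def eY (n : ℕ) (i : Fin (n - 1)) : Fin (2 * n) := ⟨i.val + 1, by omega⟩
def eZ (n : ℕ) (i : Fin (n - 1)) : Fin (2 * n) := ⟨i.val + n, by omega⟩
def eW (n : ℕ) (hn : 2 ≤ n) : Fin (2 * n) := ⟨2 * n - 1, by omega⟩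

lemma idx_cases (n : ℕ) (hn : 2 ≤ n) (t : Fin (2 * n)) :
    t = eX n hn ∨ (∃ i, t = eY n i) ∨ (∃ i, t = eZ n i) ∨ t = eW n hn := by
  by_cases h0 : t.val = 0
  · left; exact Fin.ext h0
  by_cases h1 : t.val ≤ n - 1
  · right; left
    exact ⟨⟨t.val - 1, by omega⟩, Fin.ext (by simp only [eY]; omega)⟩
  by_cases h2 : t.val ≤ 2 * n - 2
  · right; right; left
    exact ⟨⟨t.val - n, by omega⟩, Fin.ext (by simp only [eZ]; omega)⟩
  · right; right; right
    exact Fin.ext (by simp only [eW]; omega)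

section S
variable (n : ℕ) (p β : ℝ) (x σ : Fin (n - 1) → ℝ)

lemma S_symm (i j : Fin (2 * n)) : Sform n p x σ β i j = Sform n p x σ β j i := by
  by_cases hij : i = j
  · rw [hij]
  have hv : i.val ≠ j.val := fun h => hij (Fin.ext h)
  have hji : ¬ j = i := fun h => hij h.symm
  unfold Sform
  simp only [hij, hji, false_and, dite_false, if_false]
  split_ifs <;> first | rfl | omega

lemma S_Y (hn : 2 ≤ n) (i : Fin (n - 1)) (j : Fin (2 * n)) : Sform n p x σ β (eY n i) j =
    (if j = eX n hn then x i else 0) + (if j = eY n i then σ i else 0) := by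
  have := i.isLt
  have h1 : ¬ (i.val + 1 = 0) := by omega
  have h2 : i.val + 1 ≤ n - 1 := by omega
  have h3 : ¬ (n ≤ i.val + 1) := by omega
  have h4 : ¬ (i.val + 1 = 2 * n - 1) := by omega
  simp only [Sform, eY, eX, Fin.ext_iff]
  repeat' (first | omega | split)
  all_goals simp

lemma S_Z (i : Fin (n - 1)) (j : Fin (2 * n)) : Sform n p x σ β (eZ n i) j =
    (if j = eZ n i then σ i else 0) := by
  have := i.isLt
  simp only [Sform, eZ, Fin.ext_iff]
  repeat' (first | omega | split)
  all_goals simp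

lemma S_W (hn : 2 ≤ n) (j : Fin (2 * n)) : Sform n p x σ β (eW n hn) j =
    (if j = eW n hn then β else 0) := by
  simp only [Sform, eW, Fin.ext_iff]
  grind

lemma mv_Y (hn : 2 ≤ n) (u : Fin (2 * n) → ℝ) (i : Fin (n - 1)) :
    (Sform n p x σ β).mulVec u (eY n i) = x i * u (eX n hn) + σ i * u (eY n i) := by
  simp [Matrix.mulVec, dotProduct, S_Y (hn := hn), add_mul, Finset.sum_add_distrib]

lemma mv_Z (u : Fin (2 * n) → ℝ) (i : Fin (n - 1)) :
    (Sform n p x σ β).mulVec u (eZ n i) = σ i * u (eZ n i) := by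
  simp [Matrix.mulVec, dotProduct, S_Z]

lemma mv_W (hn : 2 ≤ n) (u : Fin (2 * n) → ℝ) :
    (Sform n p x σ β).mulVec u (eW n hn) = β * u (eW n hn) := by
  simp [Matrix.mulVec, dotProduct, S_W (hn := hn)]

lemma eY_inj : Function.Injective (eY n) := by
  intro i j h
  simp only [eY, Fin.mk.injEq] at h
  exact Fin.ext (by omega)

lemma mv_X (hn : 2 ≤ n) (u : Fin (2 * n) → ℝ) :
    (Sform n p x σ β).mulVec u (eX n hn) = p * u (eX n hn) + ∑ i, x i * u (eY n i) := by
  have h1 : ∀ j, Sform n p x σ β (eX n hn) j * u j =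
      (if j = eX n hn then p * u j else 0) +
      (if j = eX n hn then 0 else Sform n p x σ β (eX n hn) j * u j) := by
    intro j
    split_ifs with h
    · subst h; simp [Sform, eX]
    · simp
  have h2 : ∑ i, x i * u (eY n i) =
      ∑ j, (if j = eX n hn then 0 else Sform n p x σ β (eX n hn) j * u j) := by
    apply Fintype.sum_of_injective (eY n) (eY_inj n)
    · intro j hj
      rcases idx_cases n hn j with rfl | ⟨i, rfl⟩ | ⟨i, rfl⟩ | rfl
      · simp
      · exact absurd ⟨i, rfl⟩ hj
      · rw [S_symm, S_Z]
        have : ¬ eX n hn = eZ n i := by simp only [eX, eZ, Fin.mk.injEq]; omega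
        simp [this]
      · rw [S_symm, S_W]
        have : ¬ eX n hn = eW n hn := by simp only [eX, eW, Fin.mk.injEq]; omega
        simp [this]
    · intro i
      rw [S_symm, S_Y (hn := hn)]
      have : ¬ eX n hn = eY n i := by simp only [eX, eY, Fin.mk.injEq]; omega
      have h' : ¬ eY n i = eX n hn := fun h => this h.symm
      simp [this, h']
  simp only [Matrix.mulVec, dotProduct]
  rw [Finset.sum_congr rfl (fun j _ => h1 j), Finset.sum_add_distrib, h2]
  simp

lemma z_mul (hn : 2 ≤ n) (hσ : ∀ i, 1 ≤ σ i) (u : Fin (2 * n) → ℝ)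
    (hY : ∀ i, (Sform n p x σ β).mulVec u (eY n i) = 0) :
    zval n p x σ * u (eX n hn) = (Sform n p x σ β).mulVec u (eX n hn) := by
  rw [mv_X, zval, sub_mul, Finset.sum_mul, sub_eq_add_neg, ← Finset.sum_neg_distrib]
  congr 1
  apply Finset.sum_congr rfl
  intro i _
  have h := hY i
  rw [mv_Y (hn := hn)] at h
  have hs : σ i ≠ 0 := by linarith [hσ i] |> fun h : 0 < σ i => h.ne'
  field_simp
  linear_combination (-(x i)) * h

lemma S_unit (hn : 2 ≤ n) (hσ : ∀ i, 1 ≤ σ i) (hβ : 0 < β) (hz : 0 < zval n p x σ) :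
    IsUnit (Sform n p x σ β) := by
  rw [← Matrix.mulVec_injective_iff_isUnit]
  have key : ∀ u, (Sform n p x σ β).mulVec u = 0 → u = 0 := by
    intro u hu
    have hs : ∀ i, σ i ≠ 0 := fun i => by have := hσ i; positivity
    have hX : u (eX n hn) = 0 := by
      have := z_mul n p β x σ hn hσ u (fun i => by rw [hu]; rfl)
      rw [hu] at this
      simpa [hz.ne'] using this
    funext t
    rcases idx_cases n hn t with rfl | ⟨i, rfl⟩ | ⟨i, rfl⟩ | rfl
    · exact hX
    · have := mv_Y n p β x σ hn u i
      rw [hu, hX] at this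
      simpa [hs i] using this
    · have := mv_Z n p β x σ u i
      rw [hu] at this
      simpa [hs i] using this
    · have := mv_W n p β x σ hn u
      rw [hu] at this
      simpa [hβ.ne'] using this
  intro u v huv
  have := key (u - v) (by rw [Matrix.mulVec_sub]; exact sub_eq_zero.2 huv)
  exact sub_eq_zero.1 this

lemma ip_single (u : Fin (2 * n) → ℝ) (t : Fin (2 * n)) (c : ℝ) :
    ip n (Sform n p x σ β) u (Pi.single t c) = c * (Sform n p x σ β).mulVec u t := by
  rw [ip, Matrix.mulVec_single]
  simp only [dotProduct, Matrix.mulVec, Finset.mul_sum]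
  apply Finset.sum_congr rfl
  intro k _
  simp [S_symm n p β x σ t k]
  ring

lemma S_nabla (hS : IsUnit (Sform n p x σ β)) (u v : Fin (2 * n) → ℝ) :
    (Sform n p x σ β).mulVec (nabla n (Sform n p x σ β) u v) =
      (2 : ℝ)⁻¹ • koszul n (Sform n p x σ β) u v := by
  have := (Matrix.isUnit_iff_isUnit_det _).1 hS
  rw [nabla, Matrix.mulVec_smul, Matrix.mulVec_mulVec, Matrix.mul_nonsing_inv _ this,
    Matrix.one_mulVec]

end S

lemma br_single_left (n : ℕ) (a : Fin (2 * n)) (c : ℝ) (v : Fin (2 * n) → ℝ) (k) :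
    bracket n (Pi.single a c) v k = c * ∑ j, v j * structC n a j k := by
  simp only [bracket]
  rw [Finset.sum_eq_single a]
  · simp [Finset.mul_sum, mul_assoc]
  · intro b _ hb; simp [hb]
  · simp

lemma br_anti (n : ℕ) (u v : Fin (2 * n) → ℝ) (k) :
    bracket n u v k = - bracket n v u k := by
  simp only [bracket]
  rw [Finset.sum_comm, ← Finset.sum_neg_distrib]
  refine Finset.sum_congr rfl fun i _ => ?_
  rw [← Finset.sum_neg_distrib]
  refine Finset.sum_congr rfl fun j _ => ?_
  simp only [structC]
  ring

lemma br_ss (n : ℕ) (a b : Fin (2 * n)) (c d : ℝ) (k) :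
    bracket n (Pi.single a c) (Pi.single b d) k = c * d * structC n a b k := by
  rw [br_single_left, Finset.sum_eq_single b]
  · simp [mul_assoc]
  · intro j _ hb; simp [hb]
  · simp

lemma sc_X (n : ℕ) (hn : 2 ≤ n) (a b) : structC n a b (eX n hn) = 0 := by
  simp only [structC, eX, Fin.ext_iff]
  have hk : ¬ ((0:ℕ) = 2 * n - 1) := by omega
  simp only [hk, and_false, if_false, sub_zero, add_zero]
  grind

lemma sc_Y (n : ℕ) (hn : 2 ≤ n) (a b) (i : Fin (n - 1)) : structC n a b (eY n i) =
    (if a = eX n hn ∧ b = eY n i then 1 / 2 else 0)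
    - (if b = eX n hn ∧ a = eY n i then 1 / 2 else 0) := by
  have := i.isLt
  simp only [structC, eX, eY, Fin.ext_iff]
  have hk : ¬ (i.val + 1 = 2 * n - 1) := by omega
  simp only [hk, and_false, if_false, sub_zero, add_zero]
  grind

lemma sc_Z (n : ℕ) (hn : 2 ≤ n) (a b) (i : Fin (n - 1)) : structC n a b (eZ n i) =
    (if a = eX n hn ∧ b = eZ n i then 1 / 2 else 0)
    - (if b = eX n hn ∧ a = eZ n i then 1 / 2 else 0) := by
  have := i.isLt
  simp only [structC, eX, eZ, Fin.ext_iff]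
  have hk : ¬ (i.val + n = 2 * n - 1) := by omega
  simp only [hk, and_false, if_false, sub_zero, add_zero]
  grind

lemma sc_YZ (n : ℕ) (hn : 2 ≤ n) (i : Fin (n - 1)) (k) : structC n (eY n i) (eZ n i) k =
    if k = eW n hn then -1 else 0 := by
  have := i.isLt
  simp only [structC, eY, eZ, eW, Fin.ext_iff]
  grind

lemma sc_ZY (n : ℕ) (hn : 2 ≤ n) (i : Fin (n - 1)) (k) : structC n (eZ n i) (eY n i) k =
    if k = eW n hn then 1 else 0 := by
  have := i.isLt
  simp only [structC, eY, eZ, eW, Fin.ext_iff]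
  grind

lemma sc_self (n : ℕ) (a k) : structC n a a k = 0 := by
  simp only [structC]; ring

/-- No left invariant Riemannian metric on `CH(n)` is flat: the curvature
operator is not identically zero. -/
theorem not_flat (n : ℕ) (hn : 2 ≤ n) (p β : ℝ) (x σ : Fin (n - 1) → ℝ)
    (hadm : Admissible n p x σ β) (hz : 0 < zval n p x σ) :
    ∃ u v w, curv n (Sform n p x σ β) u v w ≠ 0 := by
  obtain ⟨-, hβ, -, -, hσ, -⟩ := hadm
  have hS := S_unit n p β x σ hn hσ hβ hz
  have hSn := S_nabla n p β x σ hS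
  have hinj := (Matrix.mulVec_injective_iff_isUnit).2 hS
  obtain ⟨i⟩ : Nonempty (Fin (n - 1)) := ⟨⟨0, by omega⟩⟩
  have nXY : eX n hn ≠ eY n i := by simp only [eX, eY, ne_eq, Fin.mk.injEq]; omega
  have nXZ : eX n hn ≠ eZ n i := by simp only [eX, eZ, ne_eq, Fin.mk.injEq]; omega
  have nXW : eX n hn ≠ eW n hn := by simp only [eX, eW, ne_eq, Fin.mk.injEq]; omega
  have nYZ : eY n i ≠ eZ n i := by simp only [eY, eZ, ne_eq, Fin.mk.injEq]; omega
  have nYW : eY n i ≠ eW n hn := by simp only [eY, eW, ne_eq, Fin.mk.injEq]; omega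
  have nZW : eZ n i ≠ eW n hn := by simp only [eZ, eW, ne_eq, Fin.mk.injEq]; omega
  set S := Sform n p x σ β with hSdef
  have ipY : ∀ u c, ip n S u (Pi.single (eY n i) c) =
      c * (x i * u (eX n hn) + σ i * u (eY n i)) := fun u c => by
    rw [hSdef, ip_single, mv_Y (hn := hn)]
  have ipZ : ∀ u c, ip n S u (Pi.single (eZ n i) c) = c * (σ i * u (eZ n i)) := fun u c => by
    rw [hSdef, ip_single, mv_Z]
  have ipW : ∀ u c, ip n S u (Pi.single (eW n hn) c) = c * (β * u (eW n hn)) := fun u c => by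
    rw [hSdef, ip_single, mv_W]
  -- brackets
  have hYZ : bracket n (Pi.single (eY n i) 1) (Pi.single (eZ n i) 1)
      = Pi.single (eW n hn) (-1) := by
    funext k
    rw [br_ss, sc_YZ n hn, Pi.single_apply]; simp
  have kZZ : koszul n S (Pi.single (eZ n i) 1) (Pi.single (eZ n i) 1)
      = Pi.single (eX n hn) (σ i) := by
    funext t
    have h0 : bracket n (Pi.single (eZ n i) 1) (Pi.single (eZ n i) (1:ℝ)) = 0 := by
      funext k; rw [br_ss, sc_self]; simp
    simp only [koszul, h0, ipZ, br_ss, sc_Z n hn, Pi.single_apply]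
    rw [hSdef, ip_single]
    simp [nXZ.symm]
    split_ifs <;> ring
  have kYZ : koszul n S (Pi.single (eY n i) 1) (Pi.single (eZ n i) 1)
      = (2 : ℝ) • S.mulVec (Pi.single (eW n hn) (-1 / 2)) := by
    funext t
    simp only [koszul, hYZ, ipY, ipZ, br_ss, sc_X, sc_Y n hn, sc_Z n hn]
    rw [hSdef, ip_single, Pi.smul_apply]
    simp [nXZ.symm, nXY.symm, nYZ, nYZ.symm, Matrix.mulVec_single]
    ring
  set h := nabla n S (Pi.single (eZ n i) 1) (Pi.single (eZ n i) 1) with hh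
  have hSh : S.mulVec h = (2 : ℝ)⁻¹ • Pi.single (eX n hn) (σ i) := by rw [hh, hSn, kZZ]
  have hnYZ : nabla n S (Pi.single (eY n i) 1) (Pi.single (eZ n i) 1)
      = Pi.single (eW n hn) (-1 / 2) := by
    apply hinj
    change S.mulVec _ = S.mulVec _
    rw [hSn, kYZ, smul_smul]; norm_num
  have hhX : zval n p x σ * h (eX n hn) = σ i / 2 := by
    rw [z_mul n p β x σ hn hσ h, ← hSdef, hSh]
    · simp; ring
    · intro j
      rw [← hSdef, hSh]
      have : eY n j ≠ eX n hn := by simp only [eX, eY, ne_eq, Fin.mk.injEq]; omega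
      simp [this]
  have k1 : koszul n S (Pi.single (eY n i) 1) h (eY n i) = - σ i * h (eX n hn) := by
    have h0 : bracket n (Pi.single (eY n i) 1) (Pi.single (eY n i) (1:ℝ)) = 0 := by
      funext k; rw [br_ss, sc_self]; simp
    have h1 : bracket n (Pi.single (eY n i) 1) h (eX n hn) = 0 := by
      rw [br_single_left]; simp [sc_X]
    have h2 : bracket n (Pi.single (eY n i) 1) h (eY n i) = - h (eX n hn) / 2 := by
      rw [br_single_left]
      simp [sc_Y n hn, nXY.symm]
      ring
    simp only [koszul, h0, ipY, br_anti n h, h1, h2]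
    simp [ip]
    ring
  have k2 : koszul n S (Pi.single (eZ n i) 1) (Pi.single (eW n hn) (-1 / 2)) (eY n i)
      = β / 2 := by
    simp only [koszul, ipY, ipZ, ipW, br_ss, sc_X, sc_Y n hn, sc_Z n hn, sc_YZ n hn]
    simp [nXY, nXY.symm, nXZ.symm, nXW.symm, nYZ, nYZ.symm, nYW, nYW.symm, nZW, nZW.symm]
    try ring
  have k3 : koszul n S (Pi.single (eW n hn) (-1)) (Pi.single (eZ n i) 1) (eY n i) = β := by
    simp only [koszul, ipY, ipZ, ipW, br_ss, sc_X, sc_Y n hn, sc_Z n hn, sc_ZY n hn]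
    simp [nXY, nXY.symm, nXZ.symm, nXW.symm, nYZ, nYZ.symm, nYW, nYW.symm, nZW, nZW.symm]
    try ring
  refine ⟨Pi.single (eY n i) 1, Pi.single (eZ n i) 1, Pi.single (eZ n i) 1, fun hc => ?_⟩
  have := congrArg (fun w => S.mulVec w (eY n i)) hc
  simp only [curv, ← hh, hnYZ, hYZ, Matrix.mulVec_sub, hSn, Matrix.mulVec_zero, Pi.sub_apply,
    Pi.smul_apply, k1, k2, k3, Pi.zero_apply, smul_eq_mul] at this
  have hpos : 0 < h (eX n hn) := by
    have h1 := hσ i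
    by_contra hneg
    nlinarith
  have h1 := hσ i
  nlinarith [mul_pos (lt_of_lt_of_le one_pos h1) hpos]

end CHn
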